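/- If a complete theory T is unstable, then T has c_κ-TP for every κ ≥ 2, i.e., some formula of T has the c_κ-tree property. -/

import Mathlib

/- Common definitions for formalizing "Tree properties for colored linear orders". -/

open FirstOrder FirstOrder.Language Cardinal

universe u v

namespace PaperTP

/-- Two tuples (possibly in two different structures of the same language) have the same
complete quantifier-free type. -/
def qfTypeEq (L' : FirstOrder.Language.{u, u}) {A : Type u} {B : Type u} [L'.Structure A] [L'.Structure B]
    {n : ℕ} (t : Fin n → A) (s : Fin n → B) : Prop :=
  ∀ φ : L'.Formula (Fin n), BoundedFormula.IsQF φ →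
    (Formula.Realize φ t ↔ Formula.Realize φ s)

/-- An elementary extension of the `L`-structure `M`, bundled. -/
structure ElemExtension (L : FirstOrder.Language.{u, u}) (M : Type u) [L.Structure M] :
    Type (u + 1) where
  carrier : Type u
  str : L.Structure carrier
  emb : @Language.ElementaryEmbedding L M carrier _ str

/-- A family of formulas `φs i (x, aₛ i)` (with parameters substituted for the `β`-variables) is
consistent: it is realized in some elementary extension of `M` (equivalently, it is finitely
satisfiable). -/
def Consistent {L : FirstOrder.Language.{u, u}} {M : Type u} [L.Structure M] {α β : Type} {ι : Type v}
    (φs : ι → L.Formula (α ⊕ β)) (as : ι → β → M) : Prop :=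
  ∃ E : ElemExtension L M,
    letI := E.str
    ∃ x : α → E.carrier, ∀ i, Formula.Realize (φs i) (Sum.elim x fun j => E.emb.toFun (as i j))

/-- `(a i)_{i ∈ I}` is an `I`-indexed indiscernible family of `β`-tuples in `M`. -/
def IndexedIndiscernible (L' : FirstOrder.Language.{u, u}) (I : Type u) [L'.Structure I]
    {L : FirstOrder.Language.{u, u}} {M : Type u} [L.Structure M] {β : Type} (a : I → β → M) : Prop :=
  ∀ (n : ℕ) (t s : Fin n → I), qfTypeEq L' t s →
    ∀ φ : L.Formula (Fin n × β),
      (Formula.Realize φ fun p => a (t p.1) p.2) ↔ Formula.Realize φ fun p => a (s p.1) p.2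

/-- `(a i)_{i ∈ I}` is an `I`-indexed indiscernible family of `β`-tuples in `M`, over the
parameter set `Cset`. -/
def IndexedIndiscernibleOver (L' : FirstOrder.Language.{u, u}) (I : Type u) [L'.Structure I]
    {L : FirstOrder.Language.{u, u}} {M : Type u} [L.Structure M] {β : Type}
    (Cset : Set M) (a : I → β → M) : Prop :=
  ∀ (n k : ℕ) (t s : Fin n → I) (c : Fin k → M), (∀ j, c j ∈ Cset) → qfTypeEq L' t s →
    ∀ φ : L.Formula (Fin n × β ⊕ Fin k),
      (Formula.Realize φ (Sum.elim (fun p => a (t p.1) p.2) c) ↔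
        Formula.Realize φ (Sum.elim (fun p => a (s p.1) p.2) c))

/-- The family `(b j)_{j ∈ J}` (in `N`) is locally based on the family `(a i)_{i ∈ I}` (in `M`):
for every finite set `Δ` of formulas and finite tuple `t` of indices from `J` there is a tuple `s`
of indices from `I` with the same complete quantifier-free type such that the `Δ`-types match. -/
def LocallyBased (L' : FirstOrder.Language.{u, u}) {J I : Type u} [L'.Structure J] [L'.Structure I]
    {L : FirstOrder.Language.{u, u}} {M N : Type u} [L.Structure M] [L.Structure N] {β : Type}
    (b : J → β → N) (a : I → β → M) : Prop :=
  ∀ (n : ℕ) (Δ : Set (L.Formula (Fin n × β))), Δ.Finite → ∀ t : Fin n → J,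
    ∃ s : Fin n → I, qfTypeEq L' t s ∧
      ∀ φ ∈ Δ, ((Formula.Realize φ fun p => b (t p.1) p.2) ↔
        Formula.Realize φ fun p => a (s p.1) p.2)

/-- `I`-indexed indiscernibles have the modeling property: every `I`-indexed family of tuples in
any structure `M` admits an `I`-indexed indiscernible family, in some elementary extension of `M`,
locally based on it. -/
def ModelingProperty (L' : FirstOrder.Language.{u, u}) (I : Type u) [L'.Structure I] : Prop :=
  ∀ (L : FirstOrder.Language.{u, u}) (M : Type u) (S : L.Structure M),
    letI := S
    ∀ (β : Type) (a : I → β → M),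
      ∃ E : ElemExtension L M,
        letI := E.str
        ∃ b : I → β → E.carrier,
          IndexedIndiscernible (L := L) L' I b ∧
            LocallyBased (L := L) L' b fun i x => E.emb.toFun (a i x)

/-- A Ramsey index structure: a locally finite structure with a relation symbol interpreted as a
linear (strict total) order, whose indexed indiscernibles have the modeling property. -/
def IsRamseyIndex (L' : FirstOrder.Language.{u, u}) (I : Type u) [L'.Structure I]
    (lt : L'.Relations 2) : Prop :=
  IsStrictTotalOrder I (fun a b => Structure.RelMap lt ![a, b]) ∧
  (∀ s : Set I, s.Finite →
    Set.Finite ((Substructure.closure L' s : L'.Substructure I) : Set I)) ∧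
  ModelingProperty L' I

/-! ### Colored linear orders -/

/-- The language of `κ`-colored linear orders: a binary order relation and a unary predicate for
each color in `κ`. -/
def colLang (κ : Type u) : FirstOrder.Language.{u, u} where
  Functions := fun _ => PEmpty
  Relations := fun n =>
    match n with
    | 1 => κ
    | 2 => PUnit
    | _ => PEmpty

/-- The order symbol of the colored linear order language. -/
def ltSym (κ : Type u) : (colLang κ).Relations 2 := PUnit.unit

/-- The color predicates of the colored linear order language. -/
def colSym {κ : Type u} (c : κ) : (colLang κ).Relations 1 := c

/-- The order of a structure in the colored linear order language. -/
def cLT (κ : Type u) {C : Type u} [(colLang κ).Structure C] (x y : C) : Prop :=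
  Structure.RelMap (ltSym κ) ![x, y]

/-- `x` has color `c` in a structure for the colored linear order language. -/
def HasColor (κ : Type u) {C : Type u} [(colLang κ).Structure C] (c : κ) (x : C) : Prop :=
  Structure.RelMap (colSym c) ![x]

/-- `C` is (up to isomorphism) the colored linear order `c_κ`, i.e. the Fraïssé limit of the class
of finite linear orders whose domain is partitioned into colors from `κ`: it is a countable,
ultrahomogeneous, colored linear order into which every finite `κ`-colored linear order embeds. -/
structure IsColoredLimit (κ C : Type u) [(colLang κ).Structure C] : Prop where
  strict : IsStrictTotalOrder C (cLT κ)
  partition : ∀ x : C, ∃! c : κ, HasColor κ c x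
  countable : Countable C
  ageFull : ∀ (n : ℕ) (pat : Fin n → κ), ∃ f : Fin n → C,
    (∀ i j : Fin n, i < j → cLT κ (f i) (f j)) ∧ ∀ i, HasColor κ (pat i) (f i)
  ultrahomogeneous : ∀ (n : ℕ) (s t : Fin n → C), qfTypeEq (colLang κ) s t →
    ∃ g : C ≃[colLang κ] C, ∀ i, g (s i) = t i

/-! ### Tree properties -/

/-- The family of formulas `φ (x, f i)`, indexed by `i ∈ C`, is `q`-inconsistent, where the
complete quantifier-free type `q` is represented by a tuple realizing it in `C`: whenever a tuple
`t` of indices realizes `q`, the corresponding finite set of formulas is inconsistent. -/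
def QInconsistent (L' : FirstOrder.Language.{u, u}) {C : Type u} [L'.Structure C]
    {L : FirstOrder.Language.{u, u}} {M : Type u} [L.Structure M] {α β : Type} {k : ℕ}
    (φ : L.Formula (α ⊕ β)) (q : Fin k → C) (f : C → β → M) : Prop :=
  ∀ t : Fin k → C, qfTypeEq L' q t →
    ¬ Consistent (fun _ : Fin k => φ) fun j => f (t j)

/-- `φ` has the `I`-tree property witnessed by the complete quantifier-free type of the tuple `q`:
there is a tree of parameters indexed by `I^{<ω}` all of whose branches are consistent and all of
whose families of immediate successors are `q`-inconsistent. -/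
def HasITPWith (L' : FirstOrder.Language.{u, u}) (C : Type u) [L'.Structure C]
    {L : FirstOrder.Language.{u, u}} {M : Type u} [L.Structure M] {α β : Type} {k : ℕ}
    (φ : L.Formula (α ⊕ β)) (q : Fin k → C) : Prop :=
  ∃ a : List C → β → M,
    (∀ b : ℕ → C, Consistent (fun _ : ℕ => φ) fun n => a (List.ofFn fun i : Fin n => b i)) ∧
    (∀ η : List C, QInconsistent L' φ q fun i => a (η ++ [i]))

/-- `φ` has the `I`-tree property (`I`-TP), for the index structure `C`. -/
def HasITP (L' : FirstOrder.Language.{u, u}) (C : Type u) [L'.Structure C]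
    {L : FirstOrder.Language.{u, u}} {M : Type u} [L.Structure M] {α β : Type}
    (φ : L.Formula (α ⊕ β)) : Prop :=
  ∃ (k : ℕ) (q : Fin k → C), HasITPWith L' C (M := M) φ q

/-- `φ` has `I`-TP₂ witnessed by the complete quantifier-free type of the tuple `q`: there is an
array of parameters, with rows indexed by `C`, such that all paths are consistent while every row
is `q`-inconsistent. -/
def HasITP2With (L' : FirstOrder.Language.{u, u}) (C : Type u) [L'.Structure C]
    {L : FirstOrder.Language.{u, u}} {M : Type u} [L.Structure M] {α β : Type} {k : ℕ}
    (φ : L.Formula (α ⊕ β)) (q : Fin k → C) : Prop :=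
  ∃ a : ℕ → C → β → M,
    (∀ f : ℕ → C, Consistent (fun _ : ℕ => φ) fun i => a i (f i)) ∧
    (∀ i : ℕ, QInconsistent L' φ q (a i))

/-- `φ` has `I`-TP₂, for the index structure `C`. -/
def HasITP2 (L' : FirstOrder.Language.{u, u}) (C : Type u) [L'.Structure C]
    {L : FirstOrder.Language.{u, u}} {M : Type u} [L.Structure M] {α β : Type}
    (φ : L.Formula (α ⊕ β)) : Prop :=
  ∃ (k : ℕ) (q : Fin k → C), HasITP2With L' C (M := M) φ q

/-- The classical tree property: a tree of parameters indexed by `ω^{<ω}` with consistent branches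
and `k`-inconsistent siblings. -/
def HasTP {L : FirstOrder.Language.{u, u}} {M : Type u} [L.Structure M] {α β : Type}
    (φ : L.Formula (α ⊕ β)) : Prop :=
  ∃ (a : List ℕ → β → M) (k : ℕ), 0 < k ∧
    (∀ b : ℕ → ℕ, Consistent (fun _ : ℕ => φ) fun n => a (List.ofFn fun i : Fin n => b i)) ∧
    (∀ (η : List ℕ) (t : Fin k → ℕ), Function.Injective t →
      ¬ Consistent (fun _ : Fin k => φ) fun j => a (η ++ [t j]))

/-- The classical tree property of the first kind (TP₁): a tree of parameters indexed by `ω^{<ω}`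
in which all initial segments of nodes are consistent and any `k` pairwise incomparable nodes are
inconsistent. -/
def HasTP1 {L : FirstOrder.Language.{u, u}} {M : Type u} [L.Structure M] {α β : Type}
    (φ : L.Formula (α ⊕ β)) : Prop :=
  ∃ (a : List ℕ → β → M) (k : ℕ), 0 < k ∧
    (∀ η : List ℕ, Consistent (fun i : Fin (η.length + 1) => φ) fun i => a (η.take i)) ∧
    (∀ t : Fin k → List ℕ, (∀ i j, i ≠ j → ¬ t i <+: t j) →
      ¬ Consistent (fun _ : Fin k => φ) fun j => a (t j))

/-- The conjunction `ψ (x; y₀, …, y_{c-1}) = ⋀_{i<c} φ (x, yᵢ)` of `c` instances of `φ` has TP₁;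
the parameters of `ψ` are organized as `c`-tuples of `β`-tuples. -/
def ConjHasTP1 {L : FirstOrder.Language.{u, u}} {M : Type u} [L.Structure M] {α β : Type}
    (φ : L.Formula (α ⊕ β)) (c : ℕ) : Prop :=
  ∃ (a : List ℕ → Fin c → β → M) (k : ℕ), 0 < k ∧
    (∀ η : List ℕ, Consistent (fun p : Fin (η.length + 1) × Fin c => φ)
      fun p => a (η.take p.1) p.2) ∧
    (∀ t : Fin k → List ℕ, (∀ i j, i ≠ j → ¬ t i <+: t j) →
      ¬ Consistent (fun _ : Fin k × Fin c => φ) fun p => a (t p.1) p.2)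

/-- The structure, in the language of `κ`-colored linear orders, on the tree of nodes `C^{<ω}`:
nodes are compared in the lexicographic order of the tree, and each node (other than the root)
carries the color of its last entry. -/
def nodeStructure (κ C : Type u) [(colLang κ).Structure C] :
    (colLang κ).Structure (List C) where
  funMap := fun {n} f _ => PEmpty.elim f
  RelMap := fun {n} =>
    match n with
    | 0 => fun r _ => PEmpty.elim r
    | 1 => fun c x => ∃ (η : List C) (i : C), x 0 = η ++ [i] ∧ HasColor κ c i
    | 2 => fun _ x => List.Lex (cLT κ) (x 0) (x 1)
    | (_ + 3) => fun r _ => PEmpty.elim r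

/-- `φ` has c-TP₁ witnessed by the complete quantifier-free type of the tuple `q` from the colored
linear order `C`: there is a tree of parameters indexed by `C^{<ω}` in which all initial segments
of nodes are consistent, while any pairwise incomparable nodes whose quantifier-free type in the
language of `C` (nodes carrying the colors of their last entries, ordered lexicographically) is
`q` are inconsistent. -/
def HasCTP1With (κ C : Type u) [(colLang κ).Structure C]
    {L : FirstOrder.Language.{u, u}} {M : Type u} [L.Structure M] {α β : Type} {k : ℕ}
    (φ : L.Formula (α ⊕ β)) (q : Fin k → C) : Prop :=
  ∃ a : List C → β → M,
    (∀ η : List C, Consistent (fun i : Fin (η.length + 1) => φ) fun i => a (η.take i)) ∧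
    (∀ t : Fin k → List C, (∀ i j, i ≠ j → ¬ t i <+: t j) →
      (letI := nodeStructure κ C; qfTypeEq (colLang κ) q t) →
      ¬ Consistent (fun _ : Fin k => φ) fun j => a (t j))

/-- `φ` has c-TP₁, for the colored linear order `C`. -/
def HasCTP1 (κ C : Type u) [(colLang κ).Structure C]
    {L : FirstOrder.Language.{u, u}} {M : Type u} [L.Structure M] {α β : Type}
    (φ : L.Formula (α ⊕ β)) : Prop :=
  ∃ (k : ℕ) (q : Fin k → C), HasCTP1With κ C (M := M) φ q

/-! ### Stability, IP, and order indiscernibles -/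

/-- `φ (x, y)` is unstable (has the order property). -/
def HasOrderProperty {L : FirstOrder.Language.{u, u}} {M : Type u} [L.Structure M] {α β : Type}
    (φ : L.Formula (α ⊕ β)) : Prop :=
  ∃ (a : ℕ → α → M) (b : ℕ → β → M),
    ∀ i j : ℕ, Formula.Realize φ (Sum.elim (a i) (b j)) ↔ i < j

/-- `(a i)_{i<ω}` is an indiscernible sequence of `γ`-tuples. -/
def OrderIndiscernible {L : FirstOrder.Language.{u, u}} {M : Type u} [L.Structure M] {γ : Type}
    (a : ℕ → γ → M) : Prop :=
  ∀ (n : ℕ) (t s : Fin n → ℕ), StrictMono t → StrictMono s →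
    ∀ φ : L.Formula (Fin n × γ),
      (Formula.Realize φ fun p => a (t p.1) p.2) ↔ Formula.Realize φ fun p => a (s p.1) p.2

/-- `φ (x, y)` has the independence property: there is an indiscernible sequence `(a i)` such that
`{φ (x, aᵢ) : i even} ∪ {¬ φ (x, aᵢ) : i odd}` is consistent. -/
def HasIP {L : FirstOrder.Language.{u, u}} {M : Type u} [L.Structure M] {α β : Type}
    (φ : L.Formula (α ⊕ β)) : Prop :=
  ∃ a : ℕ → β → M, OrderIndiscernible (L := L) a ∧
    ∃ E : ElemExtension L M,
      letI := E.str
      ∃ x : α → E.carrier, ∀ i : ℕ,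
        (Even i → Formula.Realize φ (Sum.elim x fun j => E.emb.toFun (a i j))) ∧
        (¬ Even i → ¬ Formula.Realize φ (Sum.elim x fun j => E.emb.toFun (a i j)))

/-- The conjunction `ψ (x; y₀, …, y_{c-1}) = ⋀_{i<c} φ (x, yᵢ)` of `c` instances of `φ` has the
independence property; the parameters of `ψ` are organized as `c`-tuples of `β`-tuples. -/
def ConjHasIP {L : FirstOrder.Language.{u, u}} {M : Type u} [L.Structure M] {α β : Type}
    (φ : L.Formula (α ⊕ β)) (c : ℕ) : Prop :=
  ∃ a : ℕ → Fin c → β → M, OrderIndiscernible (L := L) (fun i (p : Fin c × β) => a i p.1 p.2) ∧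
    ∃ E : ElemExtension L M,
      letI := E.str
      ∃ x : α → E.carrier, ∀ i : ℕ,
        (Even i → ∀ m : Fin c, Formula.Realize φ (Sum.elim x fun j => E.emb.toFun (a i m j))) ∧
        (¬ Even i → ∃ m : Fin c, ¬ Formula.Realize φ (Sum.elim x fun j => E.emb.toFun (a i m j)))

/-! ### Generalized dividing and local character -/

/-- `φ (x, c)` `I`-divides over the set `B`: there is an `I`-indexed family of tuples,
indiscernible over `B`, containing `c`, such that the corresponding family of instances of `φ`
is inconsistent. -/
def FormulaDividesOver (L' : FirstOrder.Language.{u, u}) (C : Type u) [L'.Structure C]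
    {L : FirstOrder.Language.{u, u}} {M : Type u} [L.Structure M] {α β : Type}
    (φ : L.Formula (α ⊕ β)) (c : β → M) (B : Set M) : Prop :=
  ∃ (f : C → β → M) (j₀ : C), IndexedIndiscernibleOver (L := L) L' C B f ∧ f j₀ = c ∧
    ¬ Consistent (fun _ : C => φ) f

/-- `(a i)` is a `q`-inconsistent `I`-dividing chain for `φ`: the instances `φ (x, a i)` are
jointly consistent, and each `φ (x, a i)` `I`-divides over the earlier elements of the chain,
witnessed by an indiscernible family that is `q`-inconsistent for the single fixed complete
quantifier-free type represented by the tuple `q`. -/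
def QIncDividingChain (L' : FirstOrder.Language.{u, u}) (C : Type u) [L'.Structure C]
    {L : FirstOrder.Language.{u, u}} {M : Type u} [L.Structure M] {α β : Type}
    (φ : L.Formula (α ⊕ β)) {k : ℕ} (q : Fin k → C) {J : Type v} [LinearOrder J]
    (a : J → β → M) : Prop :=
  Consistent (fun _ : J => φ) a ∧
  ∀ i : J, ∃ (f : C → β → M) (j₀ : C),
    IndexedIndiscernibleOver (L := L) L' C {m : M | ∃ j x, j < i ∧ m = a j x} f ∧
    f j₀ = a i ∧ QInconsistent L' φ q f ∧ ¬ Consistent (fun _ : C => φ) f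

/-- `p` is a complete type over `A` in the variables `α`, presented as a set of formulas paired
with their parameter tuples: all parameters come from `A`, `p` is finitely satisfiable, and `p`
decides every formula with parameters in `A`. -/
def IsCompleteTypeOver (L : FirstOrder.Language.{u, u}) (M : Type u) [L.Structure M] (A : Set M)
    (α : Type) (p : Set (Σ k : ℕ, L.Formula (α ⊕ Fin k) × (Fin k → M))) : Prop :=
  (∀ ψ ∈ p, ∀ j, ψ.2.2 j ∈ A) ∧
  (∀ S ⊆ p, S.Finite →
    ∃ E : ElemExtension L M,
      letI := E.str
      ∃ x : α → E.carrier, ∀ ψ ∈ S,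
        Formula.Realize ψ.2.1 (Sum.elim x fun j => E.emb.toFun (ψ.2.2 j))) ∧
  (∀ (k : ℕ) (φ : L.Formula (α ⊕ Fin k)) (c : Fin k → M), (∀ j, c j ∈ A) →
    (⟨k, φ, c⟩ ∈ p ∨ ⟨k, BoundedFormula.not φ, c⟩ ∈ p))

/-- The type `p` `I`-divides over the set `B` if some formula in it does. -/
def TypeDividesOver (L' : FirstOrder.Language.{u, u}) (C : Type u) [L'.Structure C]
    {L : FirstOrder.Language.{u, u}} {M : Type u} [L.Structure M] {α : Type}
    (p : Set (Σ k : ℕ, L.Formula (α ⊕ Fin k) × (Fin k → M))) (B : Set M) : Prop :=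
  ∃ ψ ∈ p, FormulaDividesOver L' C ψ.2.1 ψ.2.2 B

/-- Equality of complete quantifier-free types is an equivalence relation on `n`-tuples. -/
def qfSetoid (L' : FirstOrder.Language.{u, u}) (C : Type u) [L'.Structure C] (n : ℕ) :
    Setoid (Fin n → C) :=
  ⟨fun t s => qfTypeEq L' t s,
    fun _ _ _ => Iff.rfl,
    fun h φ hφ => (h φ hφ).symm,
    fun h₁ h₂ φ hφ => (h₁ φ hφ).trans (h₂ φ hφ)⟩

/-- The number of complete quantifier-free types of `C` in finitely many variables. -/
def numQfTypes (L' : FirstOrder.Language.{u, u}) (C : Type u) [L'.Structure C] : Cardinal.{u} :=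
  #(Σ n : ℕ, Quotient (qfSetoid L' C n))

/-- `I`-dividing has local character (for the complete theory of `M`): every complete type over
any set `A` fails to `I`-divide over some subset of `A` of size at most `|T| + κ`, where `κ` is
the number of complete quantifier-free types of the index structure in finitely many variables. -/
def LocalChar (L : FirstOrder.Language.{u, u}) (M : Type u) [L.Structure M]
    (L' : FirstOrder.Language.{u, u}) (C : Type u) [L'.Structure C] : Prop :=
  ∀ (α : Type) (A : Set M) (p : Set (Σ k : ℕ, L.Formula (α ⊕ Fin k) × (Fin k → M))),
    IsCompleteTypeOver L M A α p →
    ∃ B : Set M, B ⊆ A ∧ #B ≤ Language.card L + ℵ₀ + numQfTypes L' C ∧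
      ¬ TypeDividesOver L' C p B

/-! ### Monster models -/

/-- `M` is `κ̄`-saturated: every finitely satisfiable family of formulas whose parameters form a
set of size `< κ̄` is realized in `M`. -/
def Saturated (L : FirstOrder.Language.{u, u}) (M : Type u) [L.Structure M]
    (κbar : Cardinal.{u}) : Prop :=
  ∀ (α : Type) (ι : Type u) (ks : ι → ℕ) (φs : ∀ i, L.Formula (α ⊕ Fin (ks i)))
    (as : ∀ i, Fin (ks i) → M),
    #(⋃ i, Set.range (as i)) < κbar →
    (∀ s : Set ι, s.Finite → ∃ x : α → M, ∀ i ∈ s, Formula.Realize (φs i) (Sum.elim x (as i))) →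
    ∃ x : α → M, ∀ i, Formula.Realize (φs i) (Sum.elim x (as i))

/-- `M` is a monster model (relative to the bound `κ̄`): it is infinite, `κ̄`-saturated, and `κ̄`
is an uncountable strong limit. -/
def IsMonster (L : FirstOrder.Language.{u, u}) (M : Type u) [L.Structure M]
    (κbar : Cardinal.{u}) : Prop :=
  Infinite M ∧ Saturated L M κbar ∧ ℵ₀ < κbar ∧
    ∀ μ : Cardinal.{u}, μ < κbar → 2 ^ μ < κbar

/-! ### Maps between colored linear order languages -/

/-- Two tuples in structures of two different languages related by a language morphism have
corresponding quantifier-free types. -/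
def qfTypeEqAlong {L₁ L₂ : FirstOrder.Language.{u, u}} (Φ : L₁ →ᴸ L₂) {A B : Type u}
    [L₁.Structure A] [L₂.Structure B] {n : ℕ} (t : Fin n → A) (s : Fin n → B) : Prop :=
  ∀ φ : L₁.Formula (Fin n), BoundedFormula.IsQF φ →
    (Formula.Realize φ t ↔ Formula.Realize (LHom.onFormula Φ φ) s)

/-- The morphism of colored linear order languages induced by a map of colors. -/
def colMap {σ τ : Type u} (i : σ → τ) : colLang σ →ᴸ colLang τ where
  onFunction := fun {_} f => PEmpty.elim f
  onRelation := fun {n} =>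
    match n with
    | 0 => fun r => PEmpty.elim r
    | 1 => fun c => i c
    | 2 => fun r => r
    | (_ + 3) => fun r => PEmpty.elim r

/-! ### Generalized tree and array index structures -/

/-- The relational version `L'ᵣ` of a language `L'`: every `n`-ary function symbol is replaced by
an `(n+1)`-ary relation symbol. -/
def relationalize (L' : FirstOrder.Language.{u, u}) : FirstOrder.Language.{u, u} where
  Functions := fun _ => PEmpty
  Relations := fun n =>
    match n with
    | 0 => L'.Relations 0
    | (m + 1) => L'.Relations (m + 1) ⊕ L'.Functions m

/-- Interpret the relationalized language `L'ᵣ` on a type `A` that contains disjoint copies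
`emb b : I → A` of the `L'`-structure `I`: relations (and graphs of functions) hold only within a
single copy, where they are computed in `I`. -/
def relationalizeStructure (L' : FirstOrder.Language.{u, u}) {I A B : Type u} [L'.Structure I]
    (emb : B → I → A) : (relationalize L').Structure A where
  funMap := fun {_} f _ => PEmpty.elim f
  RelMap := fun {n} =>
    match n with
    | 0 => fun r _ => Structure.RelMap (L := L') (M := I) r fun j : Fin 0 => j.elim0
    | (m + 1) => fun r x =>
      match r with
      | Sum.inl r => ∃ (b : B) (ids : Fin (m + 1) → I),
          (∀ j, x j = emb b (ids j)) ∧ Structure.RelMap (M := I) r ids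
      | Sum.inr f => ∃ (b : B) (ids : Fin (m + 1) → I),
          (∀ j, x j = emb b (ids j)) ∧
            Structure.funMap (M := I) f (fun j : Fin m => ids j.castSucc) = ids (Fin.last m)

/-- The base language of trees: the tree partial order `⊴`, the lexicographic order `<ₗₑₓ`, and
the binary meet function `∧`. -/
def treeBase : FirstOrder.Language.{u, u} where
  Functions := fun n =>
    match n with
    | 2 => PUnit.{u + 1}
    | _ => PEmpty.{u + 1}
  Relations := fun n =>
    match n with
    | 2 => (PUnit.{u + 1} ⊕ PUnit.{u + 1} : Type u)
    | _ => PEmpty.{u + 1}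

/-- The longest common prefix (meet) of two finite sequences. -/
noncomputable def lcp {I : Type u} : List I → List I → List I
  | a :: as, b :: bs => if Classical.propDecidable (a = b) |>.decide then a :: lcp as bs else []
  | _, _ => []

/-- The base tree structure on `I^{<ω}`: `⊴` is the prefix (tree) order, `<ₗₑₓ` the lexicographic
order induced by the order `r` on `I`, and `∧` the longest common prefix. -/
noncomputable def treeBaseStructure (I : Type u) (r : I → I → Prop) :
    treeBase.Structure (List I) where
  funMap := fun {n} f x =>
    match n, f with
    | 0, f => PEmpty.elim f
    | 1, f => PEmpty.elim f
    | 2, _ => lcp (x 0) (x 1)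
    | (_ + 3), f => PEmpty.elim f
  RelMap := fun {n} R x =>
    match n, R with
    | 0, R => PEmpty.elim R
    | 1, R => PEmpty.elim R
    | 2, Sum.inl _ => x 0 <+: x 1
    | 2, Sum.inr _ => List.Lex r (x 0) (x 1)
    | (_ + 3), R => PEmpty.elim R

/-- The language of level predicates `P_α` for `α < ω`. -/
def levelLang : FirstOrder.Language.{u, u} where
  Functions := fun _ => PEmpty
  Relations := fun n =>
    match n with
    | 1 => ULift ℕ
    | _ => PEmpty

/-- The interpretation of the level predicates on a tree `I^{<ω}`: `P_α` holds of exactly the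
nodes of length `α`. -/
def levelStructure (I : Type u) : levelLang.Structure (List I) where
  funMap := fun {_} f _ => PEmpty.elim f
  RelMap := fun {n} R x =>
    match n, R with
    | 1, m => (x 0).length = m.down

/-- The language `L_{0,I}` for trees over the index structure `I`. -/
def treeLang0 (L' : FirstOrder.Language.{u, u}) : FirstOrder.Language.{u, u} :=
  treeBase.sum (relationalize L')

/-- The language `L_{s,ω,I}` for trees of height `ω` over the index structure `I`. -/
def treeLangS (L' : FirstOrder.Language.{u, u}) : FirstOrder.Language.{u, u} :=
  (treeLang0 L').sum levelLang

/-- The `L_{0,I}`-structure on the tree `I^{<ω}`, where the set of immediate successors of any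
node is a copy of `I`. -/
noncomputable def treeStructure0 (L' : FirstOrder.Language.{u, u}) (I : Type u) [L'.Structure I]
    (lt : L'.Relations 2) : (treeLang0 L').Structure (List I) :=
  letI := treeBaseStructure I fun a b => Structure.RelMap lt ![a, b]
  letI := relationalizeStructure L' fun (η : List I) (i : I) => η ++ [i]
  inferInstanceAs ((treeBase.sum (relationalize L')).Structure (List I))

/-- The `L_{s,ω,I}`-structure on the tree `I^{<ω}`. -/
noncomputable def treeStructureS (L' : FirstOrder.Language.{u, u}) (I : Type u) [L'.Structure I]
    (lt : L'.Relations 2) : (treeLangS L').Structure (List I) :=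
  letI := treeStructure0 L' I lt
  letI := levelStructure I
  inferInstanceAs (((treeLang0 L').sum levelLang).Structure (List I))

/-- The base language of arrays: a linear order and an equivalence relation. -/
def arrayBase : FirstOrder.Language.{u, u} where
  Functions := fun _ => PEmpty
  Relations := fun n =>
    match n with
    | 2 => (PUnit.{u + 1} ⊕ PUnit.{u + 1} : Type u)
    | _ => PEmpty.{u + 1}

/-- The convexly ordered equivalence relation on `K × I` whose classes are the rows
`{α} × I`. -/
def arrayBaseStructure (K I : Type u) [LinearOrder K] (r : I → I → Prop) :
    arrayBase.Structure (K × I) where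
  funMap := fun {_} f _ => PEmpty.elim f
  RelMap := fun {n} R x =>
    match n, R with
    | 0, R => PEmpty.elim R
    | 1, R => PEmpty.elim R
    | 2, Sum.inl _ => (x 0).1 < (x 1).1 ∨ ((x 0).1 = (x 1).1 ∧ r (x 0).2 (x 1).2)
    | 2, Sum.inr _ => (x 0).1 = (x 1).1
    | (_ + 3), R => PEmpty.elim R

/-- The language of `I`-arrays: a convexly ordered equivalence relation together with the
relational version of the language of `I`. -/
def arrayLang (L' : FirstOrder.Language.{u, u}) : FirstOrder.Language.{u, u} :=
  arrayBase.sum (relationalize L')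

/-- The structure of a convexly ordered equivalence relation on `K × I` whose classes are the
copies `{α} × I` of `I` (with functions of `I` replaced by their graphs on each copy). -/
def arrayStructure (L' : FirstOrder.Language.{u, u}) (K I : Type u) [LinearOrder K]
    [L'.Structure I] (lt : L'.Relations 2) : (arrayLang L').Structure (K × I) :=
  letI := arrayBaseStructure K I fun a b => Structure.RelMap lt ![a, b]
  letI := relationalizeStructure L' fun (k : K) (i : I) => (k, i)
  inferInstanceAs ((arrayBase.sum (relationalize L')).Structure (K × I))

/-- A `K × I`-array of tuples is mutually `I`-indiscernible: each row is an `I`-indexed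
indiscernible family over the entries of all the other rows. -/
def MutuallyIndiscernible (L' : FirstOrder.Language.{u, u}) (I : Type u) [L'.Structure I]
    {L : FirstOrder.Language.{u, u}} {M : Type u} [L.Structure M] {K : Type u} {β : Type}
    (a : K → I → β → M) : Prop :=
  ∀ i : K, IndexedIndiscernibleOver (L := L) L' I
    {m : M | ∃ k j x, k ≠ i ∧ m = a k j x} (a i)

/-- A `K × I`-array of tuples is strongly `I`-indiscernible: it is mutually `I`-indiscernible and
the sequence of its rows is an indiscernible sequence. -/
def StronglyIndiscernibleArray (L' : FirstOrder.Language.{u, u}) (I : Type u) [L'.Structure I]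
    {L : FirstOrder.Language.{u, u}} {M : Type u} [L.Structure M] {K : Type u} [LinearOrder K]
    {β : Type} (a : K → I → β → M) : Prop :=
  MutuallyIndiscernible (L := L) L' I a ∧
  ∀ (n : ℕ) (t s : Fin n → K), StrictMono t → StrictMono s →
    ∀ φ : L.Formula (Fin n × (I × β)),
      ((Formula.Realize φ fun p => a (t p.1) p.2.1 p.2.2) ↔
        Formula.Realize φ fun p => a (s p.1) p.2.1 p.2.2)


open Classical in
/-- Children of a dyadic interval: left half for color `c`, right half otherwise. -/
noncomputable def ivStep {C : Type u} (P : C → Prop) (p : ℚ × ℚ) (i : C) : ℚ × ℚ :=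
  if P i then (p.1, (p.1 + p.2) / 2) else ((p.1 + p.2) / 2, p.2)

/-- The dyadic interval attached to a node. -/
noncomputable def iv {C : Type u} (P : C → Prop) (η : List C) : ℚ × ℚ :=
  η.foldl (ivStep P) (0, 1)

theorem iv_append {C : Type u} (P : C → Prop) (η : List C) (i : C) :
    iv P (η ++ [i]) = ivStep P (iv P η) i := by
  simp [iv, List.foldl_append]

theorem ivStep_prop {C : Type u} (P : C → Prop) (p : ℚ × ℚ) (i : C) (h : p.1 < p.2) :
    p.1 ≤ (ivStep P p i).1 ∧ (ivStep P p i).1 < (ivStep P p i).2 ∧ (ivStep P p i).2 ≤ p.2 := by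
  unfold ivStep
  split_ifs <;> refine ⟨?_, ?_, ?_⟩ <;> dsimp only <;> linarith

theorem iv_branch_succ {C : Type u} (P : C → Prop) (b : ℕ → C) (n : ℕ) :
    iv P (List.ofFn fun i : Fin (n + 1) => b i) =
      ivStep P (iv P (List.ofFn fun i : Fin n => b i)) (b n) := by
  rw [← iv_append, List.ofFn_succ']
  simp [List.concat_eq_append]

theorem iv_branch_lt {C : Type u} (P : C → Prop) (b : ℕ → C) (n : ℕ) :
    (iv P (List.ofFn fun i : Fin n => b i)).1 < (iv P (List.ofFn fun i : Fin n => b i)).2 := by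
  induction n with
  | zero => simp [iv]
  | succ n ih =>
    rw [iv_branch_succ]
    exact (ivStep_prop P _ _ ih).2.1

theorem iv_branch_mono {C : Type u} (P : C → Prop) (b : ℕ → C) (n d : ℕ) :
    (iv P (List.ofFn fun i : Fin n => b i)).1 ≤ (iv P (List.ofFn fun i : Fin (n + d) => b i)).1 ∧
    (iv P (List.ofFn fun i : Fin (n + d) => b i)).2 ≤ (iv P (List.ofFn fun i : Fin n => b i)).2 := by
  induction d with
  | zero => exact ⟨le_rfl, le_rfl⟩
  | succ d ih =>
    have h := ivStep_prop P _ (b (n + d)) (iv_branch_lt P b (n + d))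
    rw [← iv_branch_succ] at h
    exact ⟨ih.1.trans h.1, h.2.2.trans ih.2⟩

/-- In a saturated model the order property is witnessed along the rationals. -/
theorem order_rat (L : FirstOrder.Language.{u, u}) (M : Type u) [L.Structure M]
    (κbar : Cardinal.{u}) (hM : IsMonster L M κbar) {mx my : ℕ}
    (φ : L.Formula (Fin mx ⊕ Fin my)) (h : HasOrderProperty (M := M) φ) :
    ∃ (a : ℚ → Fin mx → M) (b : ℚ → Fin my → M),
      ∀ r s : ℚ, Formula.Realize φ (Sum.elim (a r) (b s)) ↔ r < s := by
  classical
  obtain ⟨_, hsat, hk, _⟩ := hM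
  obtain ⟨a, b, hab⟩ := h
  let φ' : ℚ → ℚ → L.Formula (((Fin mx × ℚ) ⊕ (Fin my × ℚ)) ⊕ Fin 0) := fun r s =>
    φ.relabel (Sum.elim (fun i => Sum.inl (Sum.inl (i, r))) (fun j => Sum.inl (Sum.inr (j, s))))
  have hφ' : ∀ (r s : ℚ) (x : ((Fin mx × ℚ) ⊕ (Fin my × ℚ)) → M) (e : Fin 0 → M),
      (φ' r s).Realize (Sum.elim x e) ↔
        φ.Realize (Sum.elim (fun i => x (Sum.inl (i, r))) (fun j => x (Sum.inr (j, s)))) := by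
    intro r s x e
    simp only [φ', Formula.realize_relabel]
    rw [Sum.comp_elim]
    rfl
  obtain ⟨x, hx⟩ := hsat ((Fin mx × ℚ) ⊕ (Fin my × ℚ)) (ULift.{u} (ℚ × ℚ)) (fun _ => 0)
    (fun p => if p.down.1 < p.down.2 then φ' p.down.1 p.down.2 else (φ' p.down.1 p.down.2).not)
    (fun _ j => j.elim0)
    (by
      refine lt_of_eq_of_lt ?_ (lt_trans Cardinal.aleph0_pos hk)
      rw [Cardinal.mk_eq_zero_iff]
      refine ⟨fun z => ?_⟩
      obtain ⟨z, hz⟩ := z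
      simp only [Set.mem_iUnion, Set.mem_range] at hz
      obtain ⟨_, j, _⟩ := hz
      exact j.elim0)
    (by
      intro s hs
      let F : Finset ℚ := hs.toFinset.image (fun p => p.down.1)
      let f : ℚ → ℕ := fun r => (F.filter (fun t => t < r)).card
      have hf : ∀ r ∈ F, ∀ r' : ℚ, f r < f r' ↔ r < r' := by
        intro r hr r'
        constructor
        · intro hlt
          by_contra hge
          push Not at hge
          exact absurd hlt (not_lt.mpr (Finset.card_le_card (by
            intro t ht
            simp only [Finset.mem_filter] at ht ⊢
            exact ⟨ht.1, ht.2.trans_le hge⟩)))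
        · intro hlt
          apply Finset.card_lt_card
          rw [Finset.ssubset_iff_of_subset]
          · exact ⟨r, by simp [hr, hlt], by simp⟩
          · intro t ht
            simp only [Finset.mem_filter] at ht ⊢
            exact ⟨ht.1, ht.2.trans hlt⟩
      refine ⟨Sum.elim (fun p => a (f p.2) p.1) (fun p => b (f p.2) p.1), ?_⟩
      intro p hp
      have hpF : p.down.1 ∈ F := by
        simp only [F, Finset.mem_image, Set.Finite.mem_toFinset]
        exact ⟨p, hp, rfl⟩
      have key := (hab (f p.down.1) (f p.down.2)).trans (hf _ hpF p.down.2)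
      split_ifs with hlt
      · rw [hφ']
        exact key.2 hlt
      · rw [Formula.realize_not, hφ']
        exact fun h => hlt (key.1 h))
  refine ⟨fun r i => x (Sum.inl (i, r)), fun s j => x (Sum.inr (j, s)), fun r s => ?_⟩
  have h := hx ⟨(r, s)⟩
  dsimp only at h
  split_ifs at h with hlt
  · rw [hφ'] at h
    exact ⟨fun _ => hlt, fun _ => h⟩
  · rw [Formula.realize_not, hφ'] at h
    exact ⟨fun h' => absurd h' h, fun h' => absurd h' hlt⟩

/-- If a complete theory (here, the theory of a monster model `M`) is unstable,
then it has the `c_κ`-tree property for every `κ ≥ 2`: some formula has the `c_κ`-tree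
property. -/
theorem statement_11 (L : FirstOrder.Language.{u, u}) (M : Type u) [L.Structure M]
    (κbar : Cardinal.{u}) (hM : IsMonster L M κbar)
    (κ : Type u) [Nontrivial κ] (C : Type u) [(colLang κ).Structure C]
    (hC : IsColoredLimit κ C) (hbig : Language.card L + #C < κbar)
    (h : ∃ (mx my : ℕ) (φ : L.Formula (Fin mx ⊕ Fin my)), HasOrderProperty (M := M) φ) :
    ∃ (mx my : ℕ) (φ : L.Formula (Fin mx ⊕ Fin my)), HasITP (colLang κ) C (M := M) φ := by
  classical
  obtain ⟨mx, my, φ, hφ⟩ := h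
  obtain ⟨a, b, hab⟩ := order_rat L M κbar hM φ hφ
  obtain ⟨c₀, c₁, hc⟩ := exists_pair_ne κ
  obtain ⟨q, -, hq⟩ := hC.ageFull 2 ![c₀, c₁]
  have hq0 : HasColor κ c₀ (q 0) := hq 0
  have hq1 : HasColor κ c₁ (q 1) := hq 1
  have hq1' : ¬ HasColor κ c₀ (q 1) := fun h' => hc ((hC.partition (q 1)).unique h' hq1)
  let P : C → Prop := HasColor κ c₀
  let ψ : L.Formula (Fin mx ⊕ Fin (my + my)) :=
    (φ.relabel (Sum.map id (Fin.natAdd my)) : L.Formula (Fin mx ⊕ Fin (my + my))) ⊓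
      (φ.relabel (Sum.map id (Fin.castAdd my)) : L.Formula (Fin mx ⊕ Fin (my + my))).not
  have hψ : ∀ (N : Type u) (SN : L.Structure N) (x : Fin mx → N) (y₁ y₂ : Fin my → N),
      ψ.Realize (Sum.elim x (Fin.append y₁ y₂)) ↔
        φ.Realize (Sum.elim x y₂) ∧ ¬ φ.Realize (Sum.elim x y₁) := by
    intro N SN x y₁ y₂
    simp only [ψ, Formula.realize_inf, Formula.realize_not, Formula.realize_relabel]
    have e1 : (Sum.elim x (Fin.append y₁ y₂)) ∘ (Sum.map id (Fin.natAdd my)) = Sum.elim x y₂ := by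
      funext z; rcases z with z | z <;> simp [-Fin.natAdd_eq_addNat]
    have e2 : (Sum.elim x (Fin.append y₁ y₂)) ∘ (Sum.map id (Fin.castAdd my)) = Sum.elim x y₁ := by
      funext z; rcases z with z | z <;> simp [-Fin.natAdd_eq_addNat]
    rw [e1, e2]
  let A : List C → Fin (my + my) → M := fun η => Fin.append (b (iv P η).1) (b (iv P η).2)
  refine ⟨mx, my + my, ψ, 2, q, A, ?_, ?_⟩
  · intro β
    obtain ⟨_, hsat, hk, _⟩ := hM
    obtain ⟨x, hx⟩ := hsat (Fin mx) (ULift.{u} ℕ) (fun _ => my + my) (fun _ => ψ)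
      (fun n => A (List.ofFn fun i : Fin n.down => β i))
      (by
        refine lt_of_le_of_lt ?_ hk
        exact (Set.countable_iUnion fun i => (Set.finite_range _).countable).le_aleph0)
      (by
        intro s hs
        let F : Finset ℕ := hs.toFinset.image ULift.down
        refine ⟨a (iv P (List.ofFn fun i : Fin (F.sup id) => β i)).1, ?_⟩
        intro n hn
        have hle : n.down ≤ F.sup id := Finset.le_sup (f := id) (by
          simp only [F, Finset.mem_image, Set.Finite.mem_toFinset]
          exact ⟨n, hn, rfl⟩)
        obtain ⟨d, hd⟩ := Nat.exists_eq_add_of_le hle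
        rw [hd]
        have h1 := iv_branch_mono P β n.down d
        have h2 := iv_branch_lt P β (n.down + d)
        refine (hψ M _ _ _ _).2 ⟨?_, ?_⟩
        · rw [hab]
          exact h2.trans_le h1.2
        · rw [hab]
          exact not_lt.mpr h1.1)
    exact ⟨⟨M, inferInstance, ElementaryEmbedding.refl L M⟩, x, fun n => hx ⟨n⟩⟩
  · intro η t ht hcons
    have hcol : ∀ j, (HasColor κ c₀ (q j) ↔ HasColor κ c₀ (t j)) := by
      intro j
      have := ht ((colSym c₀).formula₁ (Term.var j)) (BoundedFormula.IsAtomic.rel _ _).isQF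
      simpa [Formula.realize_rel₁, HasColor] using this
    have h0 : P (t 0) := (hcol 0).1 hq0
    have h1 : ¬ P (t 1) := fun h' => hq1' ((hcol 1).2 h')
    obtain ⟨⟨N, SN, e⟩, x, hx⟩ := hcons
    have app : ∀ η' : List C, (fun j => e.toFun (A η' j)) =
        Fin.append (fun j => e.toFun (b (iv P η').1 j)) (fun j => e.toFun (b (iv P η').2 j)) := by
      intro η'
      funext j
      refine Fin.addCases (fun j => ?_) (fun j => ?_) j <;> simp [A, -Fin.natAdd_eq_addNat]
    have hx0 := hx 0
    have hx1 := hx 1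
    dsimp only at hx0 hx1
    rw [app, hψ, iv_append] at hx0 hx1
    simp only [ivStep, if_pos h0] at hx0
    simp only [ivStep, if_neg h1] at hx1
    exact hx1.2 hx0.1

end PaperTP
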